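/- Let G be a signed graph with edge set E, a fixed orientation, and a fixed linear order ≺ on E, and let Γ be a finite additive abelian group of odd order k. Then the number of nowhere-zero Γ-flows in G equals Σ_F (−1)^{|F|} · k^{β(G−F)}, where the sum ranges over all subsets F ⊆ E that contain no broken bond of G as a subset. -/

import Mathlib

/-- A signed graph: each edge `e` has endpoints `a e`, `b e` (equal for a loop)
and a sign `sign e ∈ {1, -1}`. -/
structure SignedGraph (V E : Type) where
  a : E → V
  b : E → V
  sign : E → ℤ
  sign_unit : ∀ e, sign e = 1 ∨ sign e = -1

namespace SignedGraph

variable {V E : Type}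

/-- An orientation of a signed graph: incidence signs `ηa e`, `ηb e ∈ {1,-1}` at the
two ends of each edge, with `ηa e * ηb e = - sign e`. -/
structure Orientation (G : SignedGraph V E) where
  ηa : E → ℤ
  ηb : E → ℤ
  ηa_unit : ∀ e, ηa e = 1 ∨ ηa e = -1
  ηb_unit : ∀ e, ηb e = 1 ∨ ηb e = -1
  compat : ∀ e, ηa e * ηb e = - G.sign e

/-- Kirchhoff's law at every vertex: a `Γ`-flow. -/
def IsFlow [Fintype E] [DecidableEq V] {Γ : Type} [AddCommGroup Γ]
    (G : SignedGraph V E) (O : G.Orientation) (f : E → Γ) : Prop :=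
  ∀ v : V, ∑ e : E,
    ((if G.a e = v then O.ηa e else 0) + (if G.b e = v then O.ηb e else 0)) • f e = 0

/-- Degree of a vertex in the subgraph with edge set `S` (a loop counts twice). -/
def deg [DecidableEq V] (G : SignedGraph V E) (S : Finset E) (v : V) : ℕ :=
  ∑ e ∈ S, ((if G.a e = v then 1 else 0) + (if G.b e = v then 1 else 0))

/-- Adjacency via an edge in the edge set `S`. -/
def AdjIn (G : SignedGraph V E) (S : Finset E) (v w : V) : Prop :=
  ∃ e ∈ S, (G.a e = v ∧ G.b e = w) ∨ (G.a e = w ∧ G.b e = v)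

/-- A circuit: a nonempty edge set forming a connected 2-regular subgraph. -/
def IsCircuit [DecidableEq V] (G : SignedGraph V E) (C : Finset E) : Prop :=
  C.Nonempty ∧
  (∀ v : V, (∃ e ∈ C, G.a e = v ∨ G.b e = v) → G.deg C v = 2) ∧
  (∀ v w : V, (∃ e ∈ C, G.a e = v ∨ G.b e = v) → (∃ e ∈ C, G.a e = w ∨ G.b e = w) →
     Relation.ReflTransGen (G.AdjIn C) v w)

/-- An unbalanced circuit: a circuit with an odd number of negative edges. -/
def IsUnbalancedCircuit [DecidableEq V] (G : SignedGraph V E) (C : Finset E) : Prop :=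
  G.IsCircuit C ∧ Odd (C.filter (fun e => G.sign e = -1)).card

/-- The subgraph with edge set `S` is balanced (contains no unbalanced circuit). -/
def BalancedOn [DecidableEq V] (G : SignedGraph V E) (S : Finset E) : Prop :=
  ∀ C : Finset E, C ⊆ S → ¬ G.IsUnbalancedCircuit C

/-- A balanced signed graph: contains no unbalanced circuit. -/
def Balanced [DecidableEq V] (G : SignedGraph V E) : Prop :=
  ∀ C : Finset E, ¬ G.IsUnbalancedCircuit C

/-- An unbalanced signed graph: contains an unbalanced circuit. -/
def Unbalanced [DecidableEq V] (G : SignedGraph V E) : Prop :=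
  ∃ C : Finset E, G.IsUnbalancedCircuit C

/-- Adjacency in the whole signed graph. -/
def Adj (G : SignedGraph V E) (v w : V) : Prop :=
  ∃ e : E, (G.a e = v ∧ G.b e = w) ∨ (G.a e = w ∧ G.b e = v)

/-- A connected signed graph: every two vertices are joined by a walk. -/
def Connected (G : SignedGraph V E) : Prop :=
  ∀ v w : V, Relation.ReflTransGen G.Adj v w

/-- The setoid on vertices whose classes are the connected components. -/
def compSetoid (G : SignedGraph V E) : Setoid V :=
  ⟨Relation.EqvGen G.Adj, Relation.EqvGen.is_equivalence _⟩

/-- The connected component of a vertex. -/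
def component (G : SignedGraph V E) (v : V) : Quotient G.compSetoid :=
  Quotient.mk G.compSetoid v

/-- The number of vertices of a connected component. -/
noncomputable def compN (G : SignedGraph V E) (q : Quotient G.compSetoid) : ℕ :=
  Nat.card {v : V // G.component v = q}

/-- The number of edges of a connected component. -/
noncomputable def compM (G : SignedGraph V E) (q : Quotient G.compSetoid) : ℕ :=
  Nat.card {e : E // G.component (G.a e) = q}

/-- The connected component `q` is unbalanced (contains an unbalanced circuit). -/
def CompUnbalanced [DecidableEq V] (G : SignedGraph V E) (q : Quotient G.compSetoid) : Prop :=
  ∃ C : Finset E, G.IsUnbalancedCircuit C ∧ ∃ e ∈ C, G.component (G.a e) = q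

open Classical in
/-- `β` of a connected component: `m - n` if unbalanced, `m - n + 1` if balanced. -/
noncomputable def compBeta [DecidableEq V] (G : SignedGraph V E)
    (q : Quotient G.compSetoid) : ℕ :=
  if G.CompUnbalanced q then G.compM q - G.compN q else G.compM q + 1 - G.compN q

/-- `β(G)`: the sum of `β(ω)` over the connected components `ω` of `G`. -/
noncomputable def beta [DecidableEq V] (G : SignedGraph V E) : ℕ :=
  ∑ᶠ q : Quotient G.compSetoid, G.compBeta q

/-- `κ(G)`: the number of unbalanced connected components of `G`. -/
noncomputable def kappa [DecidableEq V] (G : SignedGraph V E) : ℕ :=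
  Nat.card {q : Quotient G.compSetoid // G.CompUnbalanced q}

/-- The signed graph `G - F` obtained by deleting the edges in `F` (all vertices kept). -/
def delete [DecidableEq E] (G : SignedGraph V E) (F : Finset E) :
    SignedGraph V {e : E // e ∉ F} :=
  ⟨fun e => G.a e.1, fun e => G.b e.1, fun e => G.sign e.1, fun e => G.sign_unit e.1⟩

/-- The edges with both endpoints in `X` (the edge set of `G[X]`). -/
def insideEdges [Fintype E] [DecidableEq V] (G : SignedGraph V E) (X : Finset V) : Finset E :=
  Finset.univ.filter (fun e => G.a e ∈ X ∧ G.b e ∈ X)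

/-- The edges with one endpoint in `X` and one outside: `[X, Xᶜ]`. -/
def crossEdges [Fintype E] [DecidableEq V] (G : SignedGraph V E) (X : Finset V) : Finset E :=
  Finset.univ.filter (fun e => (G.a e ∈ X ∧ G.b e ∉ X) ∨ (G.a e ∉ X ∧ G.b e ∈ X))

/-- A cut: a nonempty set `B = [X, Xᶜ] ∪ E_X` where `X` is a nonempty vertex set and `E_X`
is a set of edges of `G[X]` minimal with `G[X] - E_X` balanced. -/
def IsCut [Fintype E] [DecidableEq V] [DecidableEq E]
    (G : SignedGraph V E) (B : Finset E) : Prop :=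
  B.Nonempty ∧ ∃ X : Finset V, X.Nonempty ∧ ∃ EX : Finset E,
    EX ⊆ G.insideEdges X ∧
    G.BalancedOn (G.insideEdges X \ EX) ∧
    (∀ EX' ⊆ EX, G.BalancedOn (G.insideEdges X \ EX') → EX' = EX) ∧
    B = G.crossEdges X ∪ EX

/-- A bond: a cut that is minimal (under inclusion) among cuts. -/
def IsBond [Fintype E] [DecidableEq V] [DecidableEq E]
    (G : SignedGraph V E) (B : Finset E) : Prop :=
  G.IsCut B ∧ ∀ B' ⊆ B, G.IsCut B' → B' = B

/-- A broken bond: a bond minus its largest edge (w.r.t. the linear order on `E`). -/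
def IsBrokenBond [Fintype E] [DecidableEq V] [LinearOrder E]
    (G : SignedGraph V E) (D : Finset E) : Prop :=
  ∃ B : Finset E, G.IsBond B ∧ ∃ h : B.Nonempty, D = B.erase (B.max' h)

/-- `F` contains no broken bond of `G` as a subset. -/
def NoBrokenBond [Fintype E] [DecidableEq V] [LinearOrder E]
    (G : SignedGraph V E) (F : Finset E) : Prop :=
  ∀ D : Finset E, G.IsBrokenBond D → ¬ D ⊆ F

end SignedGraph

/-- `ε(Γ)`: the largest `d` such that `Γ` has a subgroup isomorphic to `(ℤ/2ℤ)^d`. -/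
noncomputable def epsilon (Γ : Type) [AddCommGroup Γ] [Fintype Γ] : ℕ :=
  sSup {d : ℕ | ∃ H : AddSubgroup Γ, Nonempty (H ≃+ (Fin d → ZMod 2))}

namespace SignedGraph

variable {V E : Type}

/-- `s` switches every edge of `S` to a positive edge. -/
def IsSwitching (G : SignedGraph V E) (S : Set E) (s : V → ℤˣ) : Prop :=
  ∀ e ∈ S, G.sign e = s (G.a e) * s (G.b e)

lemma AdjIn.mono {G : SignedGraph V E} {S T : Finset E} (h : S ⊆ T) {v w : V}
    (hvw : G.AdjIn S v w) :
    G.AdjIn T v w := by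
  obtain ⟨e, he, h'⟩ := hvw
  exact ⟨e, h he, h'⟩

lemma AdjIn.symm {G : SignedGraph V E} {S : Finset E} {v w : V} (h : G.AdjIn S v w) :
    G.AdjIn S w v := by
  obtain ⟨e, he, h'⟩ := h
  exact ⟨e, he, h'.symm⟩

lemma reachable_symm {G : SignedGraph V E} {S : Finset E} {v w : V}
    (h : Relation.ReflTransGen (G.AdjIn S) v w) :
    Relation.ReflTransGen (G.AdjIn S) w v := by
  have : Std.Symm (G.AdjIn S) := ⟨fun _ _ => AdjIn.symm⟩
  exact Relation.ReflTransGen.stdSymm.symm _ _ h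

/-- `P` is the edge set and `W` the vertex set of a path from `u` to `v`. -/
inductive IsPath [DecidableEq V] [DecidableEq E] (G : SignedGraph V E) (v : V) :
    V → Finset E → Finset V → Prop
  | nil : IsPath G v v ∅ {v}
  | cons {u u' : V} {P : Finset E} {W : Finset V} (e : E)
      (he : (G.a e = u ∧ G.b e = u') ∨ (G.a e = u' ∧ G.b e = u))
      (hu : u ∉ W) (h : IsPath G v u' P W) : IsPath G v u (insert e P) (insert u W)

section Paths

variable [DecidableEq V] [DecidableEq E] {G : SignedGraph V E}

lemma IsPath.start_mem {u v : V} {P : Finset E} {W : Finset V} (h : G.IsPath v u P W) :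
    u ∈ W := by
  cases h <;> simp

lemma IsPath.endpoints_mem {u v : V} {P : Finset E} {W : Finset V} (h : G.IsPath v u P W) :
    ∀ e ∈ P, G.a e ∈ W ∧ G.b e ∈ W := by
  induction h with
  | nil => simp
  | cons e he hu h ih =>
    have := h.start_mem
    intro e' he'
    rcases Finset.mem_insert.1 he' with rfl | he'
    · rcases he with ⟨h1, h2⟩ | ⟨h1, h2⟩ <;> simp [h1, h2, this]
    · simp [ih e' he']

lemma IsPath.edge_notMem {u u' v : V} {P : Finset E} {W : Finset V} {e : E}
    (h : G.IsPath v u' P W)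
    (he : (G.a e = u ∧ G.b e = u') ∨ (G.a e = u' ∧ G.b e = u)) (hu : u ∉ W) : e ∉ P := by
  intro hP
  have := h.endpoints_mem e hP
  rcases he with ⟨h1, h2⟩ | ⟨h1, h2⟩ <;> simp_all

lemma IsPath.exists_from {u v w : V} {P : Finset E} {W : Finset V} (h : G.IsPath v u P W)
    (hw : w ∈ W) : ∃ P' ⊆ P, ∃ W', G.IsPath v w P' W' := by
  induction h with
  | nil =>
    rw [Finset.mem_singleton] at hw
    subst hw
    exact ⟨∅, by simp, _, .nil⟩
  | cons e he hu h ih =>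
    rcases Finset.mem_insert.1 hw with rfl | hw
    · exact ⟨_, subset_rfl, _, .cons e he hu h⟩
    · obtain ⟨P', hP', W', h'⟩ := ih hw
      exact ⟨P', hP'.trans (Finset.subset_insert _ _), W', h'⟩

lemma exists_isPath {S : Finset E} {u v : V} (h : Relation.ReflTransGen (G.AdjIn S) u v) :
    ∃ P ⊆ S, ∃ W, G.IsPath v u P W := by
  induction h using Relation.ReflTransGen.head_induction_on with
  | refl => exact ⟨∅, by simp, _, .nil⟩
  | @head u u' hadj _ ih =>
    obtain ⟨P, hP, W, hPath⟩ := ih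
    obtain ⟨e, heS, he⟩ := hadj
    by_cases hu : u ∈ W
    · obtain ⟨P', hP', W', h'⟩ := hPath.exists_from hu
      exact ⟨P', hP'.trans hP, W', h'⟩
    · exact ⟨insert e P, Finset.insert_subset heS hP, _, .cons e he hu hPath⟩

lemma IsPath.deg_add {u v : V} {P : Finset E} {W : Finset V} (h : G.IsPath v u P W) (w : V) :
    G.deg P w + ((if u = w then 1 else 0) + (if v = w then 1 else 0)) =
      if w ∈ W then 2 else 0 := by
  induction h with
  | nil =>
    simp only [deg, Finset.sum_empty, Finset.mem_singleton, eq_comm (a := w)]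
    split_ifs <;> rfl
  | @cons u u' P W e he hu h ih =>
    have hdeg : G.deg (insert e P) w =
        ((if u = w then 1 else 0) + (if u' = w then 1 else 0)) + G.deg P w := by
      rw [deg, Finset.sum_insert (h.edge_notMem he hu), deg]
      rcases he with ⟨h1, h2⟩ | ⟨h1, h2⟩ <;> simp only [h1, h2, add_comm]
    have hW : (if w ∈ insert u W then 2 else 0) =
        (if w ∈ W then 2 else 0) + 2 * (if u = w then 1 else 0) := by
      by_cases huw : u = w
      · subst huw; simp [hu]
      · simp [huw, Ne.symm huw]
    rw [hdeg, hW, ← ih]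
    ring

lemma IsPath.reachable {u v : V} {P : Finset E} {W : Finset V} (h : G.IsPath v u P W) :
    ∀ w ∈ W, Relation.ReflTransGen (G.AdjIn P) u w := by
  induction h with
  | nil => simp [Relation.ReflTransGen.refl]
  | cons e he hu h ih =>
    intro w hw
    rcases Finset.mem_insert.1 hw with rfl | hw
    · exact .refl
    · exact .head ⟨e, Finset.mem_insert_self _ _, he⟩
        (Relation.ReflTransGen.mono (fun _ _ => AdjIn.mono (Finset.subset_insert _ _)) _ _
          (ih w hw))

lemma IsPath.prod_sign {u v : V} {P : Finset E} {W : Finset V} (h : G.IsPath v u P W)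
    {s : V → ℤˣ} (hs : G.IsSwitching P s) :
    ∏ e ∈ P, G.sign e = s u * s v := by
  induction h with
  | nil => simp [← Units.val_mul]
  | @cons u u' P W e he hu h ih =>
    have hP : G.IsSwitching P s := fun e he => hs e (by
      rw [Finset.coe_insert]; exact Set.mem_insert_of_mem _ he)
    rw [Finset.prod_insert (h.edge_notMem he hu), ih hP, hs e (by simp)]
    have : ((s u' : ℤˣ) : ℤ) * s u' = 1 := by simp [← Units.val_mul]
    rcases he with ⟨h1, h2⟩ | ⟨h1, h2⟩ <;> rw [h1, h2] <;> linear_combination (s u * s v : ℤ) * this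

lemma IsPath.isCircuit {u v : V} {P : Finset E} {W : Finset V} (h : G.IsPath v u P W) {e : E}
    (heP : e ∉ P) (ha : G.a e = u) (hb : G.b e = v) : G.IsCircuit (insert e P) := by
  have hdeg (w : V) : G.deg (insert e P) w = if w ∈ W then 2 else 0 := by
    rw [← h.deg_add w, deg, Finset.sum_insert heP, deg, ha, hb, add_comm]
  have hv : v ∈ W := by
    have := h.deg_add v
    by_contra hv
    simp [hv] at this
  have hmem (w : V) (hw : ∃ e' ∈ insert e P, G.a e' = w ∨ G.b e' = w) : w ∈ W := by
    obtain ⟨e', he', hw⟩ := hw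
    rcases Finset.mem_insert.1 he' with rfl | he'
    · rcases hw with rfl | rfl
      · exact ha ▸ h.start_mem
      · exact hb ▸ hv
    · rcases hw with rfl | rfl
      exacts [(h.endpoints_mem e' he').1, (h.endpoints_mem e' he').2]
  refine ⟨⟨e, Finset.mem_insert_self _ _⟩, fun w hw => by rw [hdeg, if_pos (hmem w hw)],
    fun w w' hw hw' => ?_⟩
  refine Relation.ReflTransGen.mono (fun _ _ => AdjIn.mono (Finset.subset_insert e P)) _ _ ?_
  exact (reachable_symm (h.reachable w (hmem w hw))).trans (h.reachable w' (hmem w' hw'))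

end Paths

lemma prod_sign_eq (G : SignedGraph V E) (S : Finset E) :
    ∏ e ∈ S, G.sign e = (-1) ^ (S.filter fun e => G.sign e = -1).card := by
  rw [← Finset.prod_filter_mul_prod_filter_not S (fun e => G.sign e = -1),
    Finset.prod_congr rfl (g := fun _ => (-1 : ℤ)) (by simp), Finset.prod_const,
    Finset.prod_eq_one (s := S.filter fun e => ¬ G.sign e = -1), mul_one]
  intro e he
  exact (G.sign_unit e).resolve_right (Finset.mem_filter.1 he).2

lemma sign_eq_neg_of_ne (G : SignedGraph V E) {e : E} (t : ℤˣ) (h : G.sign e ≠ t) :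
    G.sign e = -t := by
  rcases Int.units_eq_one_or t with rfl | rfl <;> rcases G.sign_unit e with h' | h' <;>
    simp_all

/-- Harary's balance theorem. -/
theorem BalancedOn.exists_isSwitching [DecidableEq V] {G : SignedGraph V E} {S : Finset E}
    (h : G.BalancedOn S) : ∃ s : V → ℤˣ, G.IsSwitching S s := by
  classical
  induction S using Finset.induction_on with
  | empty => exact ⟨1, by simp [IsSwitching]⟩
  | insert e S he ih =>
    obtain ⟨s, hs⟩ := ih fun C hC => h C (hC.trans (Finset.subset_insert _ _))
    by_cases hr : Relation.ReflTransGen (G.AdjIn S) (G.a e) (G.b e)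
    · obtain ⟨P, hP, W, hPath⟩ := exists_isPath hr
      have heP : e ∉ P := fun h => he (hP h)
      refine ⟨s, fun e' he' => ?_⟩
      rcases Finset.mem_insert.1 (Finset.mem_coe.1 he') with rfl | he'
      · by_contra hne
        rw [← Units.val_mul] at hne
        have hneg := G.sign_eq_neg_of_ne _ hne
        refine h _ (Finset.insert_subset_insert e' hP) ⟨hPath.isCircuit heP rfl rfl, ?_⟩
        have hprod : ∏ x ∈ insert e' P, G.sign x = -1 := by
          rw [Finset.prod_insert heP, hPath.prod_sign (s := s) fun x hx => hs x (hP hx), hneg,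
            ← Units.val_mul, neg_mul, ← Units.val_mul, Int.units_mul_self, Units.val_one]
        rw [prod_sign_eq] at hprod
        exact (neg_one_pow_eq_neg_one_iff_odd (by decide)).1 hprod
      · exact hs e' he'
    · let r : V → Prop := Relation.ReflTransGen (G.AdjIn S) (G.a e)
      obtain ⟨c, hc⟩ : ∃ c : ℤˣ, G.sign e = c := by
        rcases G.sign_unit e with h | h
        exacts [⟨1, h⟩, ⟨-1, h⟩]
      refine ⟨fun v => if r v then c * s (G.a e) * s (G.b e) * s v else s v, fun e' he' => ?_⟩
      rcases Finset.mem_insert.1 (Finset.mem_coe.1 he') with rfl | he'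
      · have h1 : r (G.a e') := .refl
        have h2 : ¬ r (G.b e') := hr
        simp only [h1, h2, if_true, if_false, hc, ← Units.val_mul]
        congr 1
        have h3 := Int.units_mul_self (s (G.a e'))
        have h4 := Int.units_mul_self (s (G.b e'))
        calc c = c * (s (G.a e') * s (G.a e')) * (s (G.b e') * s (G.b e')) := by
              rw [h3, h4, mul_one, mul_one]
          _ = _ := by ac_rfl
      · have hadj : G.AdjIn S (G.a e') (G.b e') := ⟨e', he', .inl ⟨rfl, rfl⟩⟩
        have hiff : r (G.a e') ↔ r (G.b e') := ⟨fun h => h.tail hadj, fun h => h.tail hadj.symm⟩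
        by_cases h1 : r (G.a e')
        · simp only [h1, hiff.1 h1, if_true, hs e' he', ← Units.val_mul]
          congr 1
          set t := c * s (G.a e) * s (G.b e)
          calc s (G.a e') * s (G.b e') = (t * t) * (s (G.a e') * s (G.b e')) := by
                rw [Int.units_mul_self, one_mul]
            _ = _ := by ac_rfl
        · have h2 := hiff.not.1 h1
          simp only [h1, h2, if_false, hs e' he']

theorem IsSwitching.balancedOn [DecidableEq V] [Fintype V] {G : SignedGraph V E} {S : Finset E}
    {s : V → ℤˣ} (hs : G.IsSwitching S s) : G.BalancedOn S := by
  intro C hC ⟨⟨_, hdeg, _⟩, hodd⟩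
  have hprod : ∏ e ∈ C, G.sign e = -1 := by rw [prod_sign_eq, hodd.neg_one_pow]
  have hcalc : ∏ e ∈ C, G.sign e = ∏ v : V, (s v : ℤ) ^ G.deg C v := by
    simp only [deg, ← Finset.prod_pow_eq_pow_sum]
    rw [Finset.prod_comm]
    refine Finset.prod_congr rfl fun e he => ?_
    rw [hs e (hC he)]
    simp only [pow_add, Finset.prod_mul_distrib, pow_ite, pow_one, pow_zero, Finset.prod_ite_eq,
      Finset.mem_univ, if_true]
  rw [hcalc, Finset.prod_eq_one] at hprod
  · norm_num at hprod
  · intro v _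
    by_cases hv : ∃ e ∈ C, G.a e = v ∨ G.b e = v
    · rw [hdeg v hv, ← Units.val_pow_eq_pow_val, Int.units_sq, Units.val_one]
    · push Not at hv
      rw [deg, Finset.sum_eq_zero fun e he => by simp [hv e he], pow_zero]

lemma AdjIn.component_eq {G : SignedGraph V E} {S : Finset E} {v w : V}
    (h : Relation.ReflTransGen (G.AdjIn S) v w) : G.component v = G.component w := by
  induction h with
  | refl => rfl
  | tail _ h ih =>
    obtain ⟨e, _, he⟩ := h
    exact ih.trans (Quotient.sound (Relation.EqvGen.rel _ _ ⟨e, he⟩))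

theorem compUnbalanced_iff [DecidableEq V] [Fintype V] [Fintype E] (G : SignedGraph V E)
    (q : Quotient G.compSetoid) :
    G.CompUnbalanced q ↔ ¬ ∃ s, G.IsSwitching {e | G.component (G.a e) = q} s := by
  classical
  constructor
  · rintro ⟨C, hC, e, heC, rfl⟩ ⟨s, hs⟩
    have hs' : G.IsSwitching C s := fun e' he' => hs e'
      (AdjIn.component_eq (hC.1.2.2 _ _ ⟨e', he', .inl rfl⟩ ⟨e, heC, .inl rfl⟩))
    exact hs'.balancedOn C subset_rfl hC
  · contrapose!
    intro hq
    refine (BalancedOn.exists_isSwitching (G := G)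
      (S := Finset.univ.filter fun e => G.component (G.a e) = q) fun C hC hun => ?_).imp
        fun s hs => ?_
    · obtain ⟨e, he⟩ := hun.1.1
      exact hq ⟨C, hun, e, he, (Finset.mem_filter.1 (hC he)).2⟩
    · simpa using hs

end SignedGraph

namespace SignedGraph

variable {V E Γ : Type} [AddCommGroup Γ]

lemma eq_zero_of_two_nsmul_eq_zero [Fintype Γ] (hodd : Odd (Fintype.card Γ)) {x : Γ}
    (hx : (2 : ℕ) • x = 0) : x = 0 := by
  obtain ⟨j, hj⟩ := hodd
  have h := card_nsmul_eq_zero (x := x)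
  rwa [hj, add_nsmul, mul_nsmul, hx, smul_zero, zero_add, one_nsmul] at h

/-- The boundary homomorphism, whose kernel consists of the flows. -/
def boundary [Fintype E] [DecidableEq V] (G : SignedGraph V E) (O : G.Orientation) (Γ : Type)
    [AddCommGroup Γ] : (E → Γ) →+ (V → Γ) where
  toFun f v := ∑ e : E,
    ((if G.a e = v then O.ηa e else 0) + (if G.b e = v then O.ηb e else 0)) • f e
  map_zero' := by ext; simp
  map_add' f g := by ext; simp [Finset.sum_add_distrib]

lemma isFlow_iff_mem_ker [Fintype E] [DecidableEq V] {G : SignedGraph V E} {O : G.Orientation}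
    {f : E → Γ} : G.IsFlow O f ↔ f ∈ (G.boundary O Γ).ker := by
  rw [AddMonoidHom.mem_ker, funext_iff]
  rfl

lemma sum_smul_boundary [Fintype E] [Fintype V] [DecidableEq V] (G : SignedGraph V E)
    (O : G.Orientation) (c : V → ℤ) (f : E → Γ) :
    ∑ v, c v • G.boundary O Γ f v =
      ∑ e, (c (G.a e) * O.ηa e + c (G.b e) * O.ηb e) • f e := by
  simp only [boundary, AddMonoidHom.coe_mk, ZeroHom.coe_mk, Finset.smul_sum]
  rw [Finset.sum_comm]
  refine Finset.sum_congr rfl fun e _ => ?_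
  simp only [smul_smul, ← Finset.sum_smul, mul_add, Finset.sum_add_distrib, mul_ite, mul_zero,
    Finset.sum_ite_eq, Finset.mem_univ, if_true]

lemma boundary_single [Fintype E] [DecidableEq E] [DecidableEq V] (G : SignedGraph V E)
    (O : G.Orientation) (e : E) (x : Γ) :
    G.boundary O Γ (Pi.single e x) =
      O.ηa e • Pi.single (G.a e) x + O.ηb e • Pi.single (G.b e) x := by
  ext v
  simp only [boundary, AddMonoidHom.coe_mk, ZeroHom.coe_mk, Pi.add_apply, Pi.smul_apply]
  rw [Finset.sum_eq_single e (fun e' _ h => by simp [h]) (by simp)]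
  simp only [Pi.single_apply, if_true, add_smul, ite_smul, zero_smul, smul_ite, smul_zero,
    eq_comm (b := v)]

lemma Orientation.ηb_eq {G : SignedGraph V E} (O : G.Orientation) (e : E) :
    O.ηb e = - (O.ηa e * G.sign e) := by
  have h := O.compat e
  rcases O.ηa_unit e with h' | h' <;> rw [h'] at h ⊢ <;> linarith

lemma single_sub_mem_range [Fintype E] [DecidableEq V] (G : SignedGraph V E)
    (O : G.Orientation) (e : E) (x : Γ) :
    (Pi.single (G.a e) x - G.sign e • Pi.single (G.b e) x : V → Γ) ∈ (G.boundary O Γ).range := by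
  classical
  refine ⟨O.ηa e • Pi.single e x, ?_⟩
  rw [map_zsmul, boundary_single, O.ηb_eq]
  rcases O.ηa_unit e with h | h <;> rw [h] <;> simp [sub_eq_add_neg]

lemma units_smul_smul (t : ℤˣ) (x : Γ) : (t : ℤ) • (t : ℤ) • x = x := by
  rw [smul_smul, ← Units.val_mul, Int.units_mul_self, Units.val_one, one_smul]

/-- In the cokernel of the boundary map, the classes supported at two vertices of the same component
agree up to sign, and every switching function determines that sign. -/
lemma exists_unit_single_sub_mem_range [Fintype E] [DecidableEq V] (G : SignedGraph V E)
    (O : G.Orientation) (Γ : Type) [AddCommGroup Γ] {v w : V} (h : Relation.EqvGen G.Adj v w) :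
    ∃ t : ℤˣ, (∀ x : Γ, (Pi.single v x - (t : ℤ) • Pi.single w x : V → Γ) ∈
      (G.boundary O Γ).range) ∧ ∀ s, G.IsSwitching Set.univ s → t = s v * s w := by
  have hsymm {v w : V} (h : ∃ t : ℤˣ, (∀ x : Γ, (Pi.single v x - (t : ℤ) • Pi.single w x : V → Γ) ∈
      (G.boundary O Γ).range) ∧ ∀ s, G.IsSwitching Set.univ s → t = s v * s w) :
      ∃ t : ℤˣ, (∀ x : Γ, (Pi.single w x - (t : ℤ) • Pi.single v x : V → Γ) ∈
      (G.boundary O Γ).range) ∧ ∀ s, G.IsSwitching Set.univ s → t = s w * s v := by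
    obtain ⟨t, h1, h2⟩ := h
    refine ⟨t, fun x => ?_, fun s hs => (h2 s hs).trans (mul_comm _ _)⟩
    convert neg_mem (AddSubgroup.zsmul_mem _ (h1 x) (t : ℤ)) using 1
    rw [smul_sub, units_smul_smul, neg_sub]
  induction h with
  | rel v w h =>
    obtain ⟨e, he⟩ := h
    obtain ⟨t, ht⟩ : ∃ t : ℤˣ, G.sign e = t := by
      rcases G.sign_unit e with h | h
      exacts [⟨1, h⟩, ⟨-1, h⟩]
    have key : ∃ t : ℤˣ, (∀ x : Γ, (Pi.single (G.a e) x - (t : ℤ) • Pi.single (G.b e) x : V → Γ) ∈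
        (G.boundary O Γ).range) ∧
        ∀ s, G.IsSwitching Set.univ s → t = s (G.a e) * s (G.b e) := by
      refine ⟨t, fun x => ht ▸ G.single_sub_mem_range O e x, fun s hs => Units.ext ?_⟩
      rw [← ht, hs e (Set.mem_univ e), Units.val_mul]
    rcases he with ⟨rfl, rfl⟩ | ⟨rfl, rfl⟩
    exacts [key, hsymm key]
  | refl v =>
    exact ⟨1, fun x => by simp, fun s _ => by simp⟩
  | symm v w _ ih => exact hsymm ih
  | trans u v w _ _ ih1 ih2 =>
    obtain ⟨t, h1, h2⟩ := ih1
    obtain ⟨t', h1', h2'⟩ := ih2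
    refine ⟨t * t', fun x => ?_, fun s hs => ?_⟩
    · convert add_mem (h1 x) (AddSubgroup.zsmul_mem _ (h1' x) (t : ℤ)) using 1
      rw [smul_sub, smul_smul, Units.val_mul]
      abel
    · rw [h2 s hs, h2' s hs, mul_assoc, ← mul_assoc (s v), Int.units_mul_self, one_mul]

lemma sub_single_mem_of_forall [Fintype V] [DecidableEq V] {v₀ : V} {t : V → ℤˣ}
    {R : AddSubgroup (V → Γ)}
    (ht : ∀ v, ∀ x : Γ, (Pi.single v x - (t v : ℤ) • Pi.single v₀ x : V → Γ) ∈ R) (g : V → Γ) :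
    g - Pi.single v₀ (∑ v, (t v : ℤ) • g v) ∈ R := by
  have := R.sum_mem (t := Finset.univ) fun v _ => ht v (g v)
  rw [Finset.sum_sub_distrib, Finset.univ_sum_single] at this
  convert this using 2
  ext w
  by_cases hw : w = v₀
  · subst hw
    simp
  · simp [hw]

section Connected

variable [Fintype V] [DecidableEq V] [Fintype E] [Fintype Γ]

lemma range_boundary_eq_top {G : SignedGraph V E} (O : G.Orientation)
    (hodd : Odd (Fintype.card Γ)) (hG : ∀ v w, Relation.EqvGen G.Adj v w) (v₀ : V)
    (hs : ¬ ∃ s, G.IsSwitching Set.univ s) : (G.boundary O Γ).range = ⊤ := by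
  choose t ht _ using fun v => G.exists_unit_single_sub_mem_range O Γ (hG v v₀)
  have hsingle (x : Γ) : Pi.single v₀ x ∈ (G.boundary O Γ).range := by
    have hneg : ¬ G.IsSwitching Set.univ t := fun h => hs ⟨t, h⟩
    simp only [IsSwitching, not_forall] at hneg
    obtain ⟨e, _, he⟩ := hneg
    rw [← Units.val_mul] at he
    have htwo (x : Γ) : Pi.single v₀ ((2 : ℕ) • x) ∈ (G.boundary O Γ).range := by
      have h0 := G.single_sub_mem_range O e x
      rw [G.sign_eq_neg_of_ne _ he] at h0
      have h1 := ht (G.a e) x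
      have h2 := AddSubgroup.zsmul_mem _ (ht (G.b e) x) ((t (G.a e) * t (G.b e) : ℤˣ) : ℤ)
      have h3 := AddSubgroup.zsmul_mem _ (sub_mem (sub_mem h0 h1) h2) (t (G.a e) : ℤ)
      convert h3 using 1
      rw [Pi.single_smul]
      simp only [smul_sub, Units.val_mul, neg_smul, smul_neg, mul_smul, units_smul_smul, two_nsmul]
      abel
    obtain ⟨j, hj⟩ := hodd
    have hx : x = (2 : ℕ) • ((j + 1) • x) := by
      have h := card_nsmul_eq_zero (x := x)
      rw [smul_smul, show 2 * (j + 1) = Fintype.card Γ + 1 by omega, add_nsmul, h, zero_add,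
        one_nsmul]
    rw [hx]
    exact htwo _
  rw [eq_top_iff]
  intro g _
  rw [← sub_add_cancel g (Pi.single v₀ (∑ v, (t v : ℤ) • g v))]
  exact add_mem (sub_single_mem_of_forall ht g) (hsingle _)

lemma card_range_boundary_mul {G : SignedGraph V E} (O : G.Orientation)
    (hG : ∀ v w, Relation.EqvGen G.Adj v w) (v₀ : V)
    {s : V → ℤˣ} (hs : G.IsSwitching Set.univ s) :
    Nat.card (G.boundary O Γ).range * Fintype.card Γ = Fintype.card Γ ^ Fintype.card V := by
  let φ : (V → Γ) →+ Γ :=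
    { toFun := fun g => ∑ v, ((s v * s v₀ : ℤˣ) : ℤ) • g v
      map_zero' := by simp
      map_add' := by simp [Finset.sum_add_distrib] }
  have hφ : Function.Surjective φ := fun x => ⟨Pi.single v₀ x, by
    change ∑ v, ((s v * s v₀ : ℤˣ) : ℤ) • (Pi.single v₀ x : V → Γ) v = x
    rw [Finset.sum_eq_single v₀ (fun v _ h => by simp [h]) (by simp), Int.units_mul_self]
    simp⟩
  have hker : φ.ker = (G.boundary O Γ).range := by
    refine le_antisymm (fun g hg => ?_) ?_
    · have ht (v : V) (x : Γ) : (Pi.single v x - ((s v * s v₀ : ℤˣ) : ℤ) • Pi.single v₀ x : V → Γ) ∈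
          (G.boundary O Γ).range := by
        obtain ⟨t, h1, h2⟩ := G.exists_unit_single_sub_mem_range O Γ (hG v v₀)
        exact h2 s hs ▸ h1 x
      have := sub_single_mem_of_forall ht g
      rwa [show ∑ v, ((s v * s v₀ : ℤˣ) : ℤ) • g v = 0 from hg, Pi.single_zero, sub_zero] at this
    · rintro _ ⟨f, rfl⟩
      refine (G.sum_smul_boundary O (fun v => ((s v * s v₀ : ℤˣ) : ℤ)) f).trans
        (Finset.sum_eq_zero fun e _ => ?_)
      rw [O.ηb_eq, hs e (Set.mem_univ e)]
      have h : ((s (G.b e) : ℤˣ) : ℤ) * s (G.b e) = 1 := by simp [← Units.val_mul]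
      convert zero_smul ℤ (f e)
      push_cast
      linear_combination (- (s (G.a e) * s v₀ * O.ηa e : ℤ)) * h
  have h := φ.ker.card_mul_index
  rw [AddSubgroup.index_ker, AddMonoidHom.range_eq_top.2 hφ, hker] at h
  simpa [Nat.card_eq_fintype_card] using h

open Classical in
theorem card_isFlow_mul {G : SignedGraph V E} (O : G.Orientation)
    (hodd : Odd (Fintype.card Γ)) (hG : ∀ v w, Relation.EqvGen G.Adj v w) (v₀ : V) :
    Nat.card {f : E → Γ // G.IsFlow O f} * Fintype.card Γ ^ Fintype.card V =
      Fintype.card Γ ^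
        (Fintype.card E + if ∃ s, G.IsSwitching Set.univ s then 1 else 0) := by
  have hcard := (G.boundary O Γ).ker.card_mul_index
  rw [AddSubgroup.index_ker] at hcard
  have hflow : Nat.card {f : E → Γ // G.IsFlow O f} = Nat.card (G.boundary O Γ).ker :=
    Nat.card_congr (Equiv.subtypeEquivRight fun f => isFlow_iff_mem_ker)
  have hE : Nat.card (E → Γ) = Fintype.card Γ ^ Fintype.card E := by
    simp [Nat.card_eq_fintype_card]
  rw [hflow, pow_add, ← hE, ← hcard, mul_assoc]
  congr 1
  split_ifs with hs
  · obtain ⟨s, hs⟩ := hs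
    rw [pow_one, card_range_boundary_mul O hG v₀ hs]
  · rw [range_boundary_eq_top O hodd hG v₀ hs]
    simp [Nat.card_eq_fintype_card]

open Classical in
theorem card_isFlow_of_connected {G : SignedGraph V E} (O : G.Orientation)
    (hodd : Odd (Fintype.card Γ)) (hG : ∀ v w, Relation.EqvGen G.Adj v w) (v₀ : V) :
    Nat.card {f : E → Γ // G.IsFlow O f} = Fintype.card Γ ^
      (Fintype.card E + (if ∃ s, G.IsSwitching Set.univ s then 1 else 0) - Fintype.card V) := by
  have hle : Fintype.card V ≤
      Fintype.card E + if ∃ s, G.IsSwitching Set.univ s then 1 else 0 := by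
    have h := card_isFlow_mul (Γ := ZMod 3) O (by simp [ZMod.card]; decide) hG v₀
    exact (Nat.pow_dvd_pow_iff_le_right (by simp [ZMod.card])).1 (Dvd.intro_left _ h)
  have hpos : 0 < Fintype.card Γ ^ Fintype.card V := pow_pos Fintype.card_pos _
  refine Nat.eq_of_mul_eq_mul_right hpos ?_
  rw [card_isFlow_mul O hodd hG v₀, ← pow_add, Nat.sub_add_cancel hle]

end Connected

end SignedGraph

namespace SignedGraph

variable {V E Γ : Type} [AddCommGroup Γ]

section Components

lemma component_b_eq (G : SignedGraph V E) (e : E) :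
    G.component (G.b e) = G.component (G.a e) :=
  Quotient.sound (.symm _ _ (.rel _ _ ⟨e, .inl ⟨rfl, rfl⟩⟩))

/-- The connected component `q` as a signed graph of its own. -/
def restrictComponent (G : SignedGraph V E) (q : Quotient G.compSetoid) :
    SignedGraph {v : V // G.component v = q} {e : E // G.component (G.a e) = q} where
  a e := ⟨G.a e, e.2⟩
  b e := ⟨G.b e, (G.component_b_eq e).trans e.2⟩
  sign e := G.sign e
  sign_unit e := G.sign_unit e

/-- The orientation induced on a connected component. -/
def Orientation.restrictComponent {G : SignedGraph V E} (O : G.Orientation)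
    (q : Quotient G.compSetoid) : (G.restrictComponent q).Orientation where
  ηa e := O.ηa e
  ηb e := O.ηb e
  ηa_unit e := O.ηa_unit e
  ηb_unit e := O.ηb_unit e
  compat e := O.compat e

lemma restrictComponent_connected (G : SignedGraph V E) (q : Quotient G.compSetoid)
    (v w : {v : V // G.component v = q}) :
    Relation.EqvGen (G.restrictComponent q).Adj v w := by
  obtain ⟨v, hv⟩ := v
  obtain ⟨w, hw⟩ := w
  have h : Relation.EqvGen G.Adj v w := Quotient.exact (hv.trans hw.symm)
  induction h with
  | rel v w h =>
    obtain ⟨e, he⟩ := h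
    have hq : G.component (G.a e) = q := by
      rcases he with ⟨rfl, rfl⟩ | ⟨rfl, rfl⟩ <;> assumption
    refine .rel _ _ ⟨⟨e, hq⟩, ?_⟩
    simpa [restrictComponent] using he
  | refl v => exact .refl _
  | symm v w _ ih => exact .symm _ _ (ih hw hv)
  | trans u v w h _ ih1 ih2 =>
    have hq : G.component v = q := (Quotient.sound (Relation.EqvGen.symm _ _ h)).trans hv
    exact .trans _ ⟨v, hq⟩ _ (ih1 hv hq) (ih2 hq hw)

lemma exists_isSwitching_restrictComponent (G : SignedGraph V E) (q : Quotient G.compSetoid) :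
    (∃ s, (G.restrictComponent q).IsSwitching Set.univ s) ↔
      ∃ s, G.IsSwitching {e | G.component (G.a e) = q} s := by
  classical
  constructor
  · rintro ⟨s, hs⟩
    refine ⟨fun v => if h : G.component v = q then s ⟨v, h⟩ else 1, fun e he => ?_⟩
    have he : G.component (G.a e) = q := he
    have hb : G.component (G.b e) = q := (G.component_b_eq e).trans he
    simp only [he, hb, dif_pos]
    exact hs ⟨e, he⟩ (Set.mem_univ _)
  · rintro ⟨s, hs⟩
    exact ⟨fun v => s v, fun e _ => hs e e.2⟩

variable [DecidableEq V] [Fintype E]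

open Classical in
lemma isFlow_iff_forall_restrictComponent {G : SignedGraph V E} {O : G.Orientation} {f : E → Γ} :
    G.IsFlow O f ↔ ∀ q, (G.restrictComponent q).IsFlow (O.restrictComponent q) fun e => f e := by
  have key (v : V) (q) (hv : G.component v = q) : ∑ e : E,
      ((if G.a e = v then O.ηa e else 0) + (if G.b e = v then O.ηb e else 0)) • f e =
      ∑ e : {e : E // G.component (G.a e) = q},
      ((if G.a e = v then O.ηa e else 0) + (if G.b e = v then O.ηb e else 0)) • f e := by
    refine (Finset.sum_bij_ne_zero (fun e _ _ => e.1) (by simp) (by simp) ?_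
      (fun _ _ _ => rfl)).symm
    intro e _ he
    have hq : G.component (G.a e) = q := by
      by_cases ha : G.a e = v
      · rw [ha, hv]
      · by_cases hb : G.b e = v
        · rw [← G.component_b_eq, hb, hv]
        · simp [ha, hb] at he
    exact ⟨⟨e, hq⟩, by simp, he, rfl⟩
  constructor
  · rintro h q ⟨v, hv⟩
    simpa [restrictComponent, Orientation.restrictComponent] using (key v q hv).symm.trans (h v)
  · intro h v
    refine (key v _ rfl).trans ?_
    simpa [restrictComponent, Orientation.restrictComponent] using h (G.component v) ⟨v, rfl⟩

open Classical in
/-- A flow is the same as a family of flows in the connected components. -/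
def flowEquiv (G : SignedGraph V E) (O : G.Orientation) (Γ : Type) [AddCommGroup Γ] :
    {f : E → Γ // G.IsFlow O f} ≃ ∀ q, {f : {e : E // G.component (G.a e) = q} → Γ //
      (G.restrictComponent q).IsFlow (O.restrictComponent q) f} where
  toFun f q := ⟨fun e => f.1 e, isFlow_iff_forall_restrictComponent.1 f.2 q⟩
  invFun g := ⟨fun e => (g (G.component (G.a e))).1 ⟨e, rfl⟩,
    isFlow_iff_forall_restrictComponent.2 fun q => by
      convert (g q).2 using 1
      ext ⟨e, rfl⟩
      rfl⟩
  left_inv f := rfl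
  right_inv g := by
    ext q ⟨e, rfl⟩
    rfl

theorem card_isFlow [Fintype V] [Fintype Γ] (G : SignedGraph V E) (O : G.Orientation)
    (hodd : Odd (Fintype.card Γ)) :
    Nat.card {f : E → Γ // G.IsFlow O f} = Fintype.card Γ ^ G.beta := by
  classical
  rw [Nat.card_congr (G.flowEquiv O Γ), Nat.card_pi, beta, finsum_eq_sum_of_fintype,
    ← Finset.prod_pow_eq_pow_sum]
  refine Finset.prod_congr rfl fun q _ => ?_
  obtain ⟨v₀, hv₀⟩ := Quotient.exists_rep q
  rw [card_isFlow_of_connected _ hodd (G.restrictComponent_connected q) ⟨v₀, hv₀⟩, compBeta, compM,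
    compN, Nat.card_eq_fintype_card, Nat.card_eq_fintype_card]
  by_cases h : ∃ s, G.IsSwitching {e | G.component (G.a e) = q} s <;>
    simp [compUnbalanced_iff, exists_isSwitching_restrictComponent, h]

end Components

section Deletion

variable [DecidableEq V] [Fintype E] [DecidableEq E]

/-- The orientation induced on `G - F`. -/
def Orientation.delete {G : SignedGraph V E} (O : G.Orientation) (F : Finset E) :
    (G.delete F).Orientation where
  ηa e := O.ηa e
  ηb e := O.ηb e
  ηa_unit e := O.ηa_unit e
  ηb_unit e := O.ηb_unit e
  compat e := O.compat e

lemma isFlow_delete_iff {G : SignedGraph V E} {O : G.Orientation} {F : Finset E} {f : E → Γ}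
    (hf : ∀ e ∈ F, f e = 0) :
    (G.delete F).IsFlow (O.delete F) (fun e => f e) ↔ G.IsFlow O f := by
  refine forall_congr' fun v => ?_
  refine Eq.congr_left (Finset.sum_bij_ne_zero (fun e _ _ => e.1) (by simp) (by simp) ?_
    fun _ _ _ => rfl)
  intro e _ he
  have : e ∉ F := fun h => he (by rw [hf e h, smul_zero])
  exact ⟨⟨e, this⟩, by simp, he, rfl⟩

/-- Flows in `G - F` are the flows in `G` that vanish on `F`. -/
def flowDeleteEquiv (G : SignedGraph V E) (O : G.Orientation) (Γ : Type) [AddCommGroup Γ]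
    (F : Finset E) :
    {f : E → Γ // G.IsFlow O f ∧ ∀ e ∈ F, f e = 0} ≃
      {f : {e // e ∉ F} → Γ // (G.delete F).IsFlow (O.delete F) f} where
  toFun f := ⟨fun e => f.1 e, (isFlow_delete_iff f.2.2).2 f.2.1⟩
  invFun g := ⟨fun e => if h : e ∈ F then 0 else g.1 ⟨e, h⟩, by
    have hF : ∀ e ∈ F, (fun e => if h : e ∈ F then 0 else g.1 ⟨e, h⟩) e = 0 :=
      fun e he => by simp [he]
    refine ⟨(isFlow_delete_iff hF).1 ?_, hF⟩
    convert g.2 using 1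
    ext e
    simp [e.2]⟩
  left_inv f := by
    ext e
    by_cases h : e ∈ F <;> simp [h, f.2.2]
  right_inv g := by
    ext e
    simp [e.2]

end Deletion

section Cuts

variable [Fintype V] [DecidableEq V] [Fintype E] [DecidableEq E]

lemma eq_zero_of_zsmul_eq_zero [Fintype Γ] (hodd : Odd (Fintype.card Γ)) {t : ℤ}
    (ht : t = 1 ∨ t = -1) {n : ℤ} (hn : n = t ∨ n = 2 * t) {x : Γ} (h : n • x = 0) : x = 0 := by
  rcases ht with rfl | rfl <;> rcases hn with rfl | rfl
  · simpa using h
  · exact eq_zero_of_two_nsmul_eq_zero hodd (by rw [two_nsmul, ← two_zsmul]; simpa using h)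
  · simpa using h
  · exact eq_zero_of_two_nsmul_eq_zero hodd (by rw [two_nsmul, ← two_zsmul]; simpa using h)

/-- A flow over a group of odd order cannot be nonzero on a single edge of a cut. -/
theorem IsCut.flow_eq_zero [Fintype Γ] (hodd : Odd (Fintype.card Γ)) {G : SignedGraph V E}
    {O : G.Orientation} {B : Finset E} (hB : G.IsCut B) {f : E → Γ} (hf : G.IsFlow O f) {e₀ : E}
    (he₀ : e₀ ∈ B) (h0 : ∀ e ∈ B.erase e₀, f e = 0) : f e₀ = 0 := by
  obtain ⟨_, X, _, EX, hEX, hbal, hmin, rfl⟩ := hB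
  obtain ⟨s, hs⟩ := hbal.exists_isSwitching
  let c : V → ℤ := fun v => if v ∈ X then s v else 0
  have hsum := G.sum_smul_boundary O c f
  rw [AddMonoidHom.mem_ker.1 (isFlow_iff_mem_ker.1 hf), Finset.sum_eq_single e₀ ?_ (by simp)]
    at hsum
  · simp only [Pi.zero_apply, smul_zero, Finset.sum_const_zero] at hsum
    have hunit (v : V) (η : ℤ) (hη : η = 1 ∨ η = -1) : (s v * η : ℤ) = 1 ∨ (s v * η : ℤ) = -1 := by
      rcases Int.units_eq_one_or (s v) with h | h <;> rcases hη with rfl | rfl <;> simp [h]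
    rcases Finset.mem_union.1 he₀ with hc | hEX₀
    · simp only [crossEdges, Finset.mem_filter, Finset.mem_univ, true_and] at hc
      rcases hc with ⟨h1, h2⟩ | ⟨h1, h2⟩
      · exact eq_zero_of_zsmul_eq_zero hodd (hunit (G.a e₀) _ (O.ηa_unit e₀))
          (.inl (by simp [c, h1, h2])) hsum.symm
      · exact eq_zero_of_zsmul_eq_zero hodd (hunit (G.b e₀) _ (O.ηb_unit e₀))
          (.inl (by simp [c, h1, h2])) hsum.symm
    · have hin := hEX hEX₀
      simp only [insideEdges, Finset.mem_filter, Finset.mem_univ, true_and] at hin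
      have hsign : G.sign e₀ ≠ (s (G.a e₀) * s (G.b e₀) : ℤˣ) := by
        intro hsign
        have hsw : G.IsSwitching (G.insideEdges X \ EX.erase e₀ : Finset E) s := by
          intro e he
          by_cases h : e = e₀
          · rw [h, hsign, Units.val_mul]
          · exact hs e (by simpa [h] using he)
        have := hmin _ (Finset.erase_subset e₀ EX) hsw.balancedOn
        exact Finset.notMem_erase e₀ EX (this.symm ▸ hEX₀)
      refine eq_zero_of_zsmul_eq_zero hodd (hunit (G.a e₀) _ (O.ηa_unit e₀)) (.inr ?_) hsum.symm
      have hb : ((s (G.b e₀) : ℤˣ) : ℤ) * s (G.b e₀) = 1 := by simp [← Units.val_mul]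
      simp only [c, hin, if_true, O.ηb_eq, G.sign_eq_neg_of_ne _ hsign, Units.val_mul]
      linear_combination (s (G.a e₀) * O.ηa e₀ : ℤ) * hb
  · intro e _ hne
    by_cases he : e ∈ G.crossEdges X ∪ EX
    · rw [h0 e (Finset.mem_erase.2 ⟨hne, he⟩), smul_zero]
    · convert zero_smul ℤ (f e)
      simp only [crossEdges, Finset.mem_union, Finset.mem_filter, Finset.mem_univ, true_and,
        not_or, not_and, not_not] at he
      obtain ⟨⟨h1, h2⟩, h3⟩ := he
      by_cases ha : G.a e ∈ X
      · have hin : e ∈ G.insideEdges X \ EX := by simp [insideEdges, ha, h1 ha, h3]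
        have hb : ((s (G.b e) : ℤˣ) : ℤ) * s (G.b e) = 1 := by simp [← Units.val_mul]
        simp only [c, ha, h1 ha, if_true, O.ηb_eq, hs e hin]
        linear_combination (- (s (G.a e) * O.ηa e : ℤ)) * hb
      · simp [c, ha, h2 ha]

end Cuts

end SignedGraph

/-- Inclusion-exclusion over the set of zeros of a function. -/
lemma card_nowhere_zero_eq_sum {E Γ : Type} [Fintype E] [DecidableEq E] [Fintype Γ] [Zero Γ]
    (p : (E → Γ) → Prop) :
    (Nat.card {f : E → Γ // p f ∧ ∀ e, f e ≠ 0} : ℤ) =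
      ∑ F : Finset E, (-1 : ℤ) ^ F.card * (Nat.card {f : E → Γ // p f ∧ ∀ e ∈ F, f e = 0} : ℤ) := by
  classical
  simp only [Nat.card_eq_fintype_card, Fintype.card_subtype, ← Finset.filter_filter,
    Finset.card_filter _ (Finset.univ.filter p), Nat.cast_sum, Finset.mul_sum]
  rw [Finset.sum_comm]
  refine Finset.sum_congr rfl fun f _ => ?_
  have h := Finset.sum_powerset_neg_one_pow_card (x := Finset.univ.filter fun e => f e = 0)
  have hiff : (Finset.univ.filter fun e => f e = 0) = ∅ ↔ ∀ e, f e ≠ 0 := by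
    simp [Finset.filter_eq_empty_iff]
  simp only [hiff] at h
  rw [Nat.cast_ite, Nat.cast_one, Nat.cast_zero, ← h]
  simp only [Nat.cast_ite, Nat.cast_one, Nat.cast_zero, mul_ite, mul_one, mul_zero,
    ← Finset.sum_filter]
  refine Finset.sum_congr ?_ fun _ _ => rfl
  ext F
  simp [Finset.subset_iff]

/-- The cancellation behind broken-circuit theorems. -/
lemma sum_neg_one_pow_card_eq_zero_of_broken {E : Type} [Fintype E] [LinearOrder E]
    (𝓑 : Finset E → Prop) (N : Finset E → ℤ)
    (hN : ∀ B, 𝓑 B → ∀ h : B.Nonempty, ∀ F, B.erase (B.max' h) ⊆ F →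
      N (insert (B.max' h) F) = N (F.erase (B.max' h)))
    (s : Finset (Finset E))
    (hs : ∀ F, F ∈ s ↔ ∃ B, 𝓑 B ∧ ∃ h : B.Nonempty, B.erase (B.max' h) ⊆ F) :
    ∑ F ∈ s, (-1 : ℤ) ^ F.card * N F = 0 := by
  classical
  let M (F : Finset E) : Finset E := Finset.univ.filter fun e =>
    ∃ B, 𝓑 B ∧ ∃ h : B.Nonempty, B.max' h = e ∧ B.erase e ⊆ F
  have hM (F : Finset E) : F ∈ s ↔ (M F).Nonempty := by
    rw [hs]
    constructor
    · rintro ⟨B, hB, h, hF⟩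
      exact ⟨B.max' h, Finset.mem_filter.2 ⟨Finset.mem_univ _, B, hB, h, rfl, hF⟩⟩
    · rintro ⟨e, he⟩
      obtain ⟨B, hB, h, rfl, hF⟩ := (Finset.mem_filter.1 he).2
      exact ⟨B, hB, h, hF⟩
  let toggle (e : E) (F : Finset E) : Finset E := if e ∈ F then F.erase e else insert e F
  have mem_toggle (e e' : E) (F : Finset E) (h : e' ≠ e) : e' ∈ toggle e F ↔ e' ∈ F := by
    by_cases he : e ∈ F <;> simp [toggle, he, h]
  have toggle_toggle (e : E) (F : Finset E) : toggle e (toggle e F) = F := by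
    by_cases he : e ∈ F <;> simp [toggle, he]
  have mem_M (e e' : E) (F : Finset E) (hle : e' ≤ e) : e' ∈ M (toggle e F) ↔ e' ∈ M F := by
    simp only [M, Finset.mem_filter, Finset.mem_univ, true_and]
    refine exists_congr fun B => and_congr_right fun _ => exists_congr fun h =>
      and_congr_right fun hmax => forall₂_congr fun x hx => mem_toggle _ _ _ ?_
    have hx' := Finset.mem_erase.1 hx
    exact ((lt_of_le_of_ne (hmax ▸ B.le_max' x hx'.2) hx'.1).trans_le hle).ne
  have nonempty_toggle (F : Finset E) (h : (M F).Nonempty) :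
      (M (toggle ((M F).min' h) F)).Nonempty :=
    ⟨(M F).min' h, (mem_M _ _ F le_rfl).2 ((M F).min'_mem h)⟩
  have min_toggle (F : Finset E) (h : (M F).Nonempty) :
      (M (toggle ((M F).min' h) F)).min' (nonempty_toggle F h) = (M F).min' h := by
    have hle := (M (toggle ((M F).min' h) F)).min'_le _
      ((mem_M _ _ F le_rfl).2 ((M F).min'_mem h))
    exact le_antisymm hle
      ((M F).min'_le _ ((mem_M _ _ F hle).1 (Finset.min'_mem _ (nonempty_toggle F h))))
  refine Finset.sum_involution (fun F hF => toggle ((M F).min' ((hM F).1 hF)) F) ?_ ?_ ?_ ?_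
  · intro F hF
    have hmem := (M F).min'_mem ((hM F).1 hF)
    set e := (M F).min' ((hM F).1 hF)
    obtain ⟨B, hB, h, hmax, hBF⟩ := (Finset.mem_filter.1 hmem).2
    have hNe := hN B hB h F (hmax.symm ▸ hBF)
    rw [hmax] at hNe
    by_cases he : e ∈ F
    · simp only [toggle, he, if_true]
      rw [Finset.insert_eq_of_mem he] at hNe
      rw [hNe, ← Finset.card_erase_add_one he, pow_succ]
      ring
    · simp only [toggle, he, if_false]
      rw [Finset.erase_eq_of_notMem he] at hNe
      rw [hNe, Finset.card_insert_of_notMem he, pow_succ]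
      ring
  · intro F hF _ heq
    set e := (M F).min' ((hM F).1 hF)
    by_cases he : e ∈ F
    · simp only [toggle, he, if_true] at heq
      exact Finset.notMem_erase e F (heq.symm ▸ he)
    · simp only [toggle, he, if_false] at heq
      exact he (heq ▸ Finset.mem_insert_self e F)
  · intro F hF
    exact (hM _).2 (nonempty_toggle F ((hM F).1 hF))
  · intro F hF
    simp only [min_toggle F ((hM F).1 hF)]
    exact toggle_toggle _ _

open Classical in
/-- Broken-bond expansion: for a signed graph `G` with a linear order on
its edges and a finite abelian group `Γ` of odd order `k`, the number of nowhere-zero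
`Γ`-flows equals `∑_F (-1)^{|F|} k^{β(G-F)}`, the sum over all `F ⊆ E` containing no
broken bond. -/
theorem nowhere_zero_flow_count_broken_bond {V E : Type}
    [Fintype V] [DecidableEq V] [Fintype E] [LinearOrder E]
    (G : SignedGraph V E) (O : G.Orientation)
    (Γ : Type) [AddCommGroup Γ] [Fintype Γ] (k : ℕ) (hk : Fintype.card Γ = k)
    (hodd : Odd k) :
    (Nat.card {f : E → Γ // G.IsFlow O f ∧ ∀ e, f e ≠ 0} : ℤ) =
      ∑ F ∈ Finset.univ.filter (fun F : Finset E => G.NoBrokenBond F),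
        (-1 : ℤ) ^ F.card * (k : ℤ) ^ (G.delete F).beta := by
  subst hk
  have hcard (F : Finset E) : ((Fintype.card Γ : ℕ) : ℤ) ^ (G.delete F).beta =
      Nat.card {f : E → Γ // G.IsFlow O f ∧ ∀ e ∈ F, f e = 0} := by
    rw [Nat.card_congr (G.flowDeleteEquiv O Γ F), (G.delete F).card_isFlow (O.delete F) hodd]
    push_cast
    rfl
  simp only [hcard]
  rw [card_nowhere_zero_eq_sum,
    ← Finset.sum_filter_add_sum_filter_not Finset.univ (fun F : Finset E => G.NoBrokenBond F)]
  refine add_eq_left.2 (sum_neg_one_pow_card_eq_zero_of_broken G.IsBond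
    (fun F => Nat.card {f : E → Γ // G.IsFlow O f ∧ ∀ e ∈ F, f e = 0}) ?_ _ ?_)
  · intro B hB h F hF
    refine congrArg Nat.cast (Nat.card_congr (Equiv.subtypeEquivRight fun f =>
      and_congr_right fun hf => ⟨fun h0 e he => ?_, fun h0 e he => ?_⟩))
    · exact h0 e (Finset.mem_insert_of_mem (Finset.mem_of_mem_erase he))
    · have hmax : f (B.max' h) = 0 := hB.1.flow_eq_zero hodd hf (B.max'_mem h) fun e he =>
        h0 e (Finset.mem_erase.2 ⟨(Finset.mem_erase.1 he).1, hF he⟩)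
      by_cases heq : e = B.max' h
      · rw [heq, hmax]
      · exact h0 e (by simpa [heq] using he)
  · intro F
    simp only [Finset.mem_filter, Finset.mem_univ, true_and, SignedGraph.NoBrokenBond, not_forall,
      not_not, SignedGraph.IsBrokenBond]
    constructor
    · rintro ⟨_, ⟨B, hB, h, rfl⟩, hF⟩
      exact ⟨B, hB, h, hF⟩
    · rintro ⟨B, hB, h, hF⟩
      exact ⟨_, ⟨B, hB, h, rfl⟩, hF⟩
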